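/- arXiv:1209.2246 — 2 statements merged into one kernel-verified Lean document; each statement's English description precedes it below -/
import Mathlib

section
/- The map F is Hölder continuous of exponent 1/2 from L² to L²: for all measurable nonnegative functions γ₁, γ₂ : S¹ → ℝ that are square integrable, ‖F(γ₁) − F(γ₂)‖_{L²(S¹×[0,∞))} ≤ (2π)^{1/4} · ‖γ₁ − γ₂‖_{L²(S¹)}^{1/2}. -/
open MeasureTheory Real Set Filter Topology

noncomputable section

instance : Fact (0 < 2 * π) := ⟨by positivity⟩

/-- The circle `ℝ / 2πℤ`. -/
abbrev S1 : Type := AddCircle (2 * π)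

/-- The Haar measure of total mass `2π` on the circle. -/
abbrev μ : Measure S1 := volume

/-- The product of `μ` with Lebesgue measure restricted to `[0, ∞)`,
modelling the measure on `S¹ × [0, ∞)`. -/
abbrev ν : Measure (S1 × ℝ) := μ.prod (volume.restrict (Ici (0:ℝ)))

/-- The characteristic function of the hypograph of `γ`:
`F γ (t, x) = 1` if `x ≤ γ t` and `0` otherwise. -/
def F (γ : S1 → ℝ) : S1 × ℝ → ℝ := fun p => if p.2 ≤ γ p.1 then 1 else 0

theorem enorm_F_sub_F_sq (γ₁ γ₂ : S1 → ℝ) (t : S1) (x : ℝ) :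
    ‖F γ₁ (t, x) - F γ₂ (t, x)‖ₑ ^ (2 : ℝ) = (uIoc (γ₁ t) (γ₂ t)).indicator 1 x := by
  by_cases ha : x ≤ γ₁ t <;> by_cases hb : x ≤ γ₂ t <;>
    simp [F, ha, hb, indicator, mem_uIoc]

theorem measurable_F {γ : S1 → ℝ} (h : Measurable γ) : Measurable (F γ) :=
  Measurable.ite (measurableSet_le measurable_snd (h.comp measurable_fst))
    measurable_const measurable_const

/-- The squared `L²` distance of the hypographs is at most the `L¹` distance of the functions. -/
theorem lintegral_enorm_F_sub_F_sq_le {γ₁ γ₂ : S1 → ℝ} (h₁ : Measurable γ₁)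
    (h₂ : Measurable γ₂) :
    ∫⁻ p, ‖F γ₁ p - F γ₂ p‖ₑ ^ (2 : ℝ) ∂ν ≤ eLpNorm (fun t => γ₁ t - γ₂ t) 1 μ := by
  have hm : Measurable fun p => ‖F γ₁ p - F γ₂ p‖ₑ ^ (2 : ℝ) :=
    ((measurable_F h₁).sub (measurable_F h₂)).enorm.pow_const _
  rw [eLpNorm_one_eq_lintegral_enorm, lintegral_prod _ hm.aemeasurable]
  refine lintegral_mono fun t => ?_
  simp only [enorm_F_sub_F_sq]
  rw [lintegral_indicator_one measurableSet_uIoc]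
  refine (Measure.restrict_apply_le _ _).trans ?_
  rw [Real.volume_uIoc, abs_sub_comm, ← Real.enorm_eq_ofReal_abs]

/-- `F` is Hölder continuous of exponent `1/2` from `L²(S¹)` to `L²(S¹ × [0,∞))`. -/
theorem F_holder_onehalf
    (γ₁ γ₂ : S1 → ℝ) (h₁ : Measurable γ₁) (h₂ : Measurable γ₂)
    (hn₁ : ∀ t, 0 ≤ γ₁ t) (hn₂ : ∀ t, 0 ≤ γ₂ t)
    (hL₁ : MemLp γ₁ 2 μ) (hL₂ : MemLp γ₂ 2 μ) :
    eLpNorm (fun p => F γ₁ p - F γ₂ p) 2 ν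
      ≤ ENNReal.ofReal ((2 * π) ^ ((1:ℝ)/4)) * eLpNorm (fun t => γ₁ t - γ₂ t) 2 μ ^ ((1:ℝ)/2) := by
  have hL1 : eLpNorm (fun t => γ₁ t - γ₂ t) 1 μ
      ≤ eLpNorm (fun t => γ₁ t - γ₂ t) 2 μ * ENNReal.ofReal (2 * π) ^ ((1 : ℝ) / 2) := by
    have h := eLpNorm_le_eLpNorm_mul_rpow_measure_univ (μ := μ) (p := 1) (q := 2)
      (f := fun t => γ₁ t - γ₂ t)
      one_le_two (h₁.sub h₂).aestronglyMeasurable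
    rw [AddCircle.measure_univ] at h
    convert h using 3
    norm_num
  rw [eLpNorm_eq_lintegral_rpow_enorm_toReal two_ne_zero ENNReal.ofNat_ne_top,
    ENNReal.toReal_ofNat]
  calc (∫⁻ p, ‖F γ₁ p - F γ₂ p‖ₑ ^ (2 : ℝ) ∂ν) ^ ((1 : ℝ) / 2)
      ≤ (eLpNorm (fun t => γ₁ t - γ₂ t) 2 μ * ENNReal.ofReal (2 * π) ^ ((1 : ℝ) / 2))
          ^ ((1 : ℝ) / 2) :=
        ENNReal.rpow_le_rpow ((lintegral_enorm_F_sub_F_sq_le h₁ h₂).trans hL1) (by norm_num)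
    _ = _ := by
      rw [ENNReal.mul_rpow_of_nonneg _ _ (by norm_num), ← ENNReal.rpow_mul, mul_comm,
        ENNReal.ofReal_rpow_of_nonneg (by positivity) (by norm_num)]
      norm_num
end
end

section
/- Directional differentiability of the similarity functional for continuous data: let u : S¹ × [0,∞) → ℝ be continuous, bounded, and square integrable, let γ : S¹ → ℝ be continuous with γ(t) > 0 for all t, and let σ : S¹ → ℝ be continuous. Define S_u(η) = ‖F(η) − u‖²_{L²(S¹×[0,∞))}. Then lim_{s → 0} (1/s)·(S_u(γ + sσ) − S_u(γ)) = ∫_{S¹} σ(t)·(1 − 2·u(t, γ(t))) dμ(t). -/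
open MeasureTheory Real Set Filter Topology

noncomputable section

/-- The square of the `L²` norm of a real function is the integral of its square. -/
lemma toReal_eLpNorm_two_sq {α : Type*} [MeasurableSpace α] {m : Measure α} {f : α → ℝ}
    (hf : MemLp f 2 m) : (eLpNorm f 2 m).toReal ^ 2 = ∫ x, f x ^ 2 ∂m := by
  have hint : 0 ≤ ∫ x, f x ^ 2 ∂m := integral_nonneg fun x => sq_nonneg (f x)
  rw [hf.eLpNorm_eq_integral_rpow_norm two_ne_zero ENNReal.ofNat_ne_top,
    ENNReal.toReal_ofReal (by positivity)]
  simp only [ENNReal.toReal_ofNat, Real.rpow_ofNat, Real.norm_eq_abs, sq_abs]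
  rw [← Real.rpow_natCast, ← Real.rpow_mul hint]
  norm_num

lemma memLp_F {η : S1 → ℝ} (hη : Continuous η) : MemLp (F η) 2 ν := by
  have hclosed : IsClosed {p : S1 × ℝ | p.2 ≤ η p.1} :=
    isClosed_le continuous_snd (hη.comp continuous_fst)
  obtain ⟨K, hK⟩ := (isCompact_range hη).bddAbove
  have hfin : ν {p : S1 × ℝ | p.2 ≤ η p.1} ≠ ⊤ := by
    have hsub : {p : S1 × ℝ | p.2 ≤ η p.1} ⊆ univ ×ˢ Iic K := fun p hp =>
      ⟨mem_univ _, le_trans hp (hK (mem_range_self p.1))⟩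
    refine ne_top_of_le_ne_top ?_ (measure_mono hsub)
    rw [Measure.prod_prod, Measure.restrict_apply measurableSet_Iic, inter_comm, Ici_inter_Iic,
      Real.volume_Icc]
    exact ENNReal.mul_ne_top (measure_ne_top _ _) ENNReal.ofReal_ne_top
  have hF : F η = {p : S1 × ℝ | p.2 ≤ η p.1}.indicator fun _ => (1 : ℝ) := by
    ext p
    simp [F, indicator_apply]
  rw [hF]
  exact memLp_indicator_const 2 hclosed.measurableSet 1 (Or.inr hfin)

/-- Integrating over the hypograph of a nonnegative `η` in the fibre over `t`. -/
lemma integral_F_mul {η : S1 → ℝ} (t : S1) (hη : 0 ≤ η t) (g : ℝ → ℝ) :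
    ∫ x in Ici (0 : ℝ), F η (t, x) * g x = ∫ x in (0 : ℝ)..η t, g x := by
  have hF : (fun x => F η (t, x) * g x) = (Iic (η t)).indicator g := by
    ext x
    simp [F, indicator_apply]
  rw [hF, setIntegral_indicator measurableSet_Iic, Ici_inter_Iic, integral_Icc_eq_integral_Ioc,
    intervalIntegral.integral_of_le hη]

lemma integrableOn_F_mul {η : S1 → ℝ} (t : S1) {g : ℝ → ℝ} (hg : Continuous g) :
    IntegrableOn (fun x => F η (t, x) * g x) (Ici (0 : ℝ)) := by
  have hF : (fun x => F η (t, x) * g x) = (Iic (η t)).indicator g := by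
    ext x
    simp [F, indicator_apply]
  rw [hF, IntegrableOn, integrable_indicator_iff measurableSet_Iic, IntegrableOn,
    Measure.restrict_restrict measurableSet_Iic, inter_comm, Ici_inter_Iic]
  exact hg.continuousOn.integrableOn_Icc

/-- The difference of two values of the similarity functional, as an integral over the region
between the two graphs. -/
lemma similarity_sub_eq_integral {u : S1 × ℝ → ℝ} (hu : Continuous u) (huL2 : MemLp u 2 ν)
    {η γ : S1 → ℝ} (hη : Continuous η) (hγ : Continuous γ) (hη0 : ∀ t, 0 ≤ η t)
    (hγ0 : ∀ t, 0 ≤ γ t) :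
    Integrable (fun t => ∫ x in γ t..η t, (1 - 2 * u (t, x))) μ ∧
    (eLpNorm (fun p => F η p - u p) 2 ν).toReal ^ 2
        - (eLpNorm (fun p => F γ p - u p) 2 ν).toReal ^ 2
      = ∫ t, (∫ x in γ t..η t, (1 - 2 * u (t, x))) ∂μ := by
  have hηL : MemLp (fun p => F η p - u p) 2 ν := (memLp_F hη).sub huL2
  have hγL : MemLp (fun p => F γ p - u p) 2 ν := (memLp_F hγ).sub huL2
  have hpt : ∀ p, (F η p - u p) ^ 2 - (F γ p - u p) ^ 2
      = F η p * (1 - 2 * u p) - F γ p * (1 - 2 * u p) := by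
    intro p
    unfold F
    split_ifs <;> ring
  have hint : Integrable (fun p => F η p * (1 - 2 * u p) - F γ p * (1 - 2 * u p)) ν :=
    (hηL.integrable_sq.sub hγL.integrable_sq).congr (Eventually.of_forall hpt)
  have hfib : ∀ t, ∫ x in Ici (0 : ℝ),
      (F η (t, x) * (1 - 2 * u (t, x)) - F γ (t, x) * (1 - 2 * u (t, x)))
      = ∫ x in γ t..η t, (1 - 2 * u (t, x)) := by
    intro t
    have hg : Continuous fun x => 1 - 2 * u (t, x) := by fun_prop
    rw [integral_sub (integrableOn_F_mul t hg) (integrableOn_F_mul t hg),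
      integral_F_mul t (hη0 t), integral_F_mul t (hγ0 t),
      intervalIntegral.integral_interval_sub_left (hg.intervalIntegrable _ _)
        (hg.intervalIntegrable _ _)]
  refine ⟨hint.integral_prod_left.congr (Eventually.of_forall hfib), ?_⟩
  rw [toReal_eLpNorm_two_sq hηL, toReal_eLpNorm_two_sq hγL,
    ← integral_sub hηL.integrable_sq hγL.integrable_sq, integral_congr_ae (Eventually.of_forall hpt),
    integral_prod _ hint]
  exact integral_congr_ae (Eventually.of_forall hfib)

/-- On a compact space, small perturbations of a positive continuous function stay nonnegative. -/
lemma eventually_forall_nonneg_add_mul {X : Type*} [TopologicalSpace X] [CompactSpace X]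
    {γ σ : X → ℝ} (hγ : Continuous γ) (hσ : Continuous σ) (hγ0 : ∀ t, 0 < γ t) :
    ∀ᶠ s in 𝓝 (0 : ℝ), ∀ t, 0 ≤ γ t + s * σ t := by
  have h : ∀ᶠ s in 𝓝 (0 : ℝ), ∀ t ∈ (univ : Set X), 0 < γ t + s * σ t := by
    refine isCompact_univ.eventually_forall_of_forall_eventually fun t _ => ?_
    have hc : Continuous fun z : ℝ × X => γ z.2 + z.1 * σ z.2 := by fun_prop
    exact hc.continuousAt.eventually (lt_mem_nhds (by simpa using hγ0 t))
  exact h.mono fun s hs t => (hs t (mem_univ t)).le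

lemma tendsto_inv_mul_integral {g : ℝ → ℝ} (hg : Continuous g) (a b : ℝ) :
    Tendsto (fun s : ℝ => (1 / s) * ∫ x in a..(a + s * b), g x) (𝓝[≠] 0) (𝓝 (b * g a)) := by
  have h1 : HasDerivAt (fun y => ∫ x in a..y, g x) (g a) (a + 0 * b) := by
    simpa using intervalIntegral.integral_hasDerivAt_right (hg.intervalIntegrable a a)
      hg.aestronglyMeasurable.stronglyMeasurableAtFilter hg.continuousAt
  have h2 : HasDerivAt (fun s : ℝ => a + s * b) b 0 := by
    simpa using ((hasDerivAt_id (0 : ℝ)).mul_const b).const_add a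
  have h3 := (h1.comp (0 : ℝ) h2).tendsto_slope_zero
  simpa [mul_comm] using h3

/-- Directional differentiability of the similarity functional
`S_u(η) = ‖F η - u‖²_{L²}` for continuous bounded square-integrable data `u`:
`(1/s)(S_u(γ + sσ) - S_u(γ)) → ∫ σ(t)(1 - 2u(t, γ(t))) dμ(t)` as `s → 0`. -/
theorem similarity_directional_derivative
    (u : S1 × ℝ → ℝ) (hu : Continuous u) (hub : ∃ M : ℝ, ∀ p, |u p| ≤ M)
    (huL2 : MemLp u 2 ν)
    (γ σ : S1 → ℝ) (hγ : Continuous γ) (hσ : Continuous σ) (hγ0 : ∀ t, 0 < γ t) :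
    Tendsto
      (fun s : ℝ => (1 / s) *
        ((eLpNorm (fun p => F (fun t => γ t + s * σ t) p - u p) 2 ν).toReal ^ 2
          - (eLpNorm (fun p => F γ p - u p) 2 ν).toReal ^ 2))
      (𝓝[≠] 0) (𝓝 (∫ t, σ t * (1 - 2 * u (t, γ t)) ∂μ)) := by
  obtain ⟨M, hM⟩ := hub
  have hev : ∀ᶠ s in 𝓝[≠] (0 : ℝ), s ≠ 0 ∧ ∀ t, 0 ≤ γ t + s * σ t :=
    (eventually_mem_nhdsWithin : ∀ᶠ s in 𝓝[≠] (0 : ℝ), s ∈ ({0}ᶜ : Set ℝ)).and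
      ((eventually_forall_nonneg_add_mul hγ hσ hγ0).filter_mono nhdsWithin_le_nhds)
  have hsub := fun (s : ℝ) (hs : ∀ t, 0 ≤ γ t + s * σ t) =>
    similarity_sub_eq_integral (η := fun t => γ t + s * σ t) hu huL2 (by fun_prop) hγ hs
      fun t => (hγ0 t).le
  have hlim : Tendsto
      (fun s : ℝ => ∫ t, (1 / s) * (∫ x in γ t..(γ t + s * σ t), (1 - 2 * u (t, x))) ∂μ)
      (𝓝[≠] 0) (𝓝 (∫ t, σ t * (1 - 2 * u (t, γ t)) ∂μ)) := by
    refine tendsto_integral_filter_of_dominated_convergence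
      (fun t => (1 + 2 * M) * |σ t|) ?_ ?_ ?_ ?_
    · filter_upwards [hev] with s hs
      exact (hsub s hs.2).1.aestronglyMeasurable.const_mul _
    · filter_upwards [hev] with s hs
      refine Eventually.of_forall fun t => ?_
      have hle : ‖∫ x in γ t..(γ t + s * σ t), (1 - 2 * u (t, x))‖
          ≤ (1 + 2 * M) * |γ t + s * σ t - γ t| := by
        refine intervalIntegral.norm_integral_le_of_norm_le_const fun x _ => ?_
        have := abs_le.1 (hM (t, x))
        exact abs_le.2 ⟨by linarith, by linarith⟩
      have hs0 : 0 < |s| := abs_pos.2 hs.1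
      rw [add_sub_cancel_left, abs_mul] at hle
      rw [norm_mul, norm_div, norm_one, Real.norm_eq_abs s, one_div, inv_mul_le_iff₀ hs0]
      linarith
    · exact (by fun_prop : Continuous fun t => (1 + 2 * M) * |σ t|).integrable_of_hasCompactSupport
        (HasCompactSupport.of_compactSpace _)
    · refine Eventually.of_forall fun t => ?_
      have hg : Continuous fun x => 1 - 2 * u (t, x) := by fun_prop
      exact tendsto_inv_mul_integral hg (γ t) (σ t)
  refine hlim.congr' ?_
  filter_upwards [hev] with s hs
  rw [(hsub s hs.2).2, integral_const_mul]
end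
end
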